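/- Let (V,b) ≈ (V',b') be nonsingular finite-dimensional metric spaces over F, and let 𝒱 = {V_0 = {0} ⊆ V_1 ⊆ V_2 ⊆ V_3 = V} and 𝒱' = {V_0' = {0} ⊆ V_1' ⊆ V_2' ⊆ V_3' = V'} be isometric self-dual flags (so V_1^⊥ = V_2, V_1'^⊥ = V_2', and dim V_1 = dim V_1'). Then an isometry φ : E → E' between subspaces E ⊆ V and E' ⊆ V' can be extended to an isometry φ_V : V → V' satisfying φ_V(V_1) = V_1' and φ_V(V_2) = V_2' if and only if φ(E ∩ V_i) = E' ∩ V_i' for i = 1, 2. -/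

import Mathlib

open Module

namespace Witt

variable {F V V' : Type*} [Field F] [AddCommGroup V] [Module F V]
  [AddCommGroup V'] [Module F V']

/-- A linear equivalence `φ : E ≃ E'` between subspaces is an isometry if it
preserves the ambient bilinear forms. -/
def IsIsometryOn (B : LinearMap.BilinForm F V) (B' : LinearMap.BilinForm F V')
    (E : Submodule F V) (E' : Submodule F V') (φ : E ≃ₗ[F] E') : Prop :=
  ∀ u v : E, B' (φ u : V') (φ v : V') = B (u : V) (v : V)

/-- A linear equivalence of the whole spaces which preserves the forms. -/
def IsIsometry (B : LinearMap.BilinForm F V) (B' : LinearMap.BilinForm F V')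
    (ψ : V ≃ₗ[F] V') : Prop :=
  ∀ u v : V, B' (ψ u) (ψ v) = B u v

/-- The two metric spaces `(V,B)` and `(V',B')` are isometric. -/
def AreIsometric (B : LinearMap.BilinForm F V) (B' : LinearMap.BilinForm F V') : Prop :=
  ∃ ψ : V ≃ₗ[F] V', IsIsometry B B' ψ

/-- The subspaces `N ⊆ V` and `N' ⊆ V'` are isometric with respect to the
restrictions of the ambient forms. -/
def SubIsometric (B : LinearMap.BilinForm F V) (B' : LinearMap.BilinForm F V')
    (N : Submodule F V) (N' : Submodule F V') : Prop :=
  ∃ ψ : N ≃ₗ[F] N', IsIsometryOn B B' N N' ψ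

/-- A subspace is totally isotropic. -/
def TotIsotropic (B : LinearMap.BilinForm F V) (N : Submodule F V) : Prop :=
  ∀ u ∈ N, ∀ v ∈ N, B u v = 0

end Witt

namespace Witt

section LinearAlgebra

variable {F X X' Z : Type*} [Field F] [AddCommGroup X] [Module F X] [AddCommGroup X']
  [Module F X'] [AddCommGroup Z] [Module F Z]

/-- Two linear maps that agree on the intersection of two subspaces have a common extension. -/
theorem exists_linearMap_eqOn_of_agree {E N : Submodule F X} (f : E →ₗ[F] X') (g : N →ₗ[F] X')
    (h : ∀ (e : E) (n : N), (e : X) = n → f e = g n) :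
    ∃ k : X →ₗ[F] X', (∀ e : E, k e = f e) ∧ ∀ n : N, k n = g n := by
  let p : X →ₗ.[F] X' := ⟨E, f⟩
  let q : X →ₗ.[F] X' := ⟨N, g⟩
  obtain ⟨k, hk⟩ := LinearMap.exists_extend (p.sup q h).toFun
  refine ⟨k, fun e ↦ ?_, fun n ↦ ?_⟩
  · have h₁ := LinearPMap.sup_apply (f := p) (g := q) h e 0
      ⟨e, Submodule.mem_sup_left e.2⟩ (by simp)
    have h₂ := LinearMap.congr_fun hk ⟨e, Submodule.mem_sup_left e.2⟩
    rw [LinearPMap.map_zero, add_zero] at h₁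
    exact h₂.trans h₁
  · have h₁ := LinearPMap.sup_apply (f := p) (g := q) h 0 n
      ⟨n, Submodule.mem_sup_right n.2⟩ (by simp)
    have h₂ := LinearMap.congr_fun hk ⟨n, Submodule.mem_sup_right n.2⟩
    rw [LinearPMap.map_zero, zero_add] at h₁
    exact h₂.trans h₁

/-- If `f` and `f'` have the same range and equidimensional finite-dimensional sources, a partial
injection `α` with `f' ∘ α = f` extends to a total one. -/
theorem exists_injective_lift_extending [FiniteDimensional F X] [FiniteDimensional F X']
    (f : X →ₗ[F] Z) (f' : X' →ₗ[F] Z) (hr : f.range = f'.range)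
    (hd : finrank F X = finrank F X') (A : Submodule F X) (α : A →ₗ[F] X')
    (hα : Function.Injective α) (hf : ∀ a, f' (α a) = f a) :
    ∃ β : X →ₗ[F] X', (∀ a : A, β a = α a) ∧ (∀ x, f' (β x) = f x) ∧ Function.Injective β := by
  induction A using WellFoundedGT.induction with
  | ind A ih =>
  by_cases hA : A = ⊤
  · subst hA
    exact ⟨α ∘ₗ (LinearEquiv.ofTop ⊤ rfl).symm.toLinearMap, fun a ↦ rfl, fun x ↦ hf _,
      hα.comp (LinearEquiv.injective _)⟩
  obtain ⟨x, hx, x', hx', hfx⟩ : ∃ x ∉ A, ∃ x' ∉ α.range, f' x' = f x := by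
    by_cases hk : f.ker ≤ A
    · obtain ⟨x, -, hx⟩ := SetLike.exists_of_lt (lt_top_iff_ne_top.2 hA)
      obtain ⟨x', hx'⟩ : f x ∈ f'.range := hr ▸ f.mem_range_self x
      refine ⟨x, hx, x', ?_, hx'⟩
      rintro ⟨a, rfl⟩
      have : x - a ∈ f.ker := by simp [← hf, hx']
      exact hx (by simpa using A.add_mem (hk this) a.2)
    · obtain ⟨x, hxk, hx⟩ := SetLike.not_le_iff_exists.1 hk
      obtain ⟨x', hxk', hx'⟩ : ∃ x' ∈ f'.ker, x' ∉ α.range := by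
        by_contra! hcon
        have h₁ : f'.ker ≤ ((f.ker).comap A.subtype).map α := by
          intro y hy
          obtain ⟨a, rfl⟩ := hcon y hy
          exact ⟨a, by simpa [hf] using hy, rfl⟩
        have h₂ := (Submodule.finrank_mono h₁).trans (Submodule.finrank_map_le _ _)
        rw [← Submodule.finrank_map_subtype_eq,
          Submodule.map_comap_subtype] at h₂
        have h₃ : A ⊓ f.ker < f.ker :=
          lt_of_le_of_ne inf_le_right fun h ↦ hx (h.ge hxk).1
        have h₄ := Submodule.finrank_lt_finrank_of_lt h₃
        have h₅ := f.finrank_range_add_finrank_ker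
        have h₆ := f'.finrank_range_add_finrank_ker
        rw [hr] at h₅
        omega
      exact ⟨x, hx, x', hx', by rw [LinearMap.mem_ker.1 hxk, LinearMap.mem_ker.1 hxk']⟩
  obtain ⟨g, hg, hgx⟩ := LinearMap.exists_extend_of_notMem α hx x'
  have hg' (a : A) : g a = α a := LinearMap.congr_fun hg a
  have hlt : A < A ⊔ F ∙ x :=
    left_lt_sup.2 fun h ↦ hx (h (Submodule.mem_span_singleton_self x))
  have key (v) (hv : v ∈ A ⊔ F ∙ x) : f' (g v) = f v ∧ (g v = 0 → v = 0) := by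
    obtain ⟨a, ha, _, hc, rfl⟩ := Submodule.mem_sup.1 hv
    obtain ⟨c, rfl⟩ := Submodule.mem_span_singleton.1 hc
    have hga := hg' ⟨a, ha⟩
    have hfa := hf ⟨a, ha⟩
    simp only at hga hfa
    refine ⟨by simp [hga, hfa, hgx, hfx], fun h0 ↦ ?_⟩
    rw [map_add, map_smul, hga, hgx] at h0
    have hc : c = 0 := by
      by_contra hc
      refine hx' ⟨(-c⁻¹) • ⟨a, ha⟩, ?_⟩
      rw [map_smul, eq_neg_of_add_eq_zero_left h0, smul_neg, neg_smul, neg_neg, smul_smul,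
        inv_mul_cancel₀ hc, one_smul]
    subst hc
    have : (⟨a, ha⟩ : A) = 0 := hα (by simpa using h0)
    simpa using this
  obtain ⟨β, hβ, hfβ, hβi⟩ := ih _ hlt (g.domRestrict _)
    ((injective_iff_map_eq_zero _).2 fun v hv ↦ Subtype.ext ((key v v.2).2 hv))
    fun v ↦ (key v v.2).1
  exact ⟨β, fun a ↦ (hβ ⟨a, hlt.le a.2⟩).trans (hg' a), hfβ, hβi⟩

end LinearAlgebra

section Isometries

variable {F V V' : Type*} [Field F] [AddCommGroup V] [Module F V] [AddCommGroup V'] [Module F V']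

/-- The reflection along an anisotropic vector exchanges two vectors of equal length whose
difference it is. -/
theorem exists_isometry_of_anisotropic_sub (B : LinearMap.BilinForm F V)
    (hB : ∀ u v, B u v = B v u) {x y : V} (hxy : B x x = B y y) (hz : B (y - x) (y - x) ≠ 0) :
    ∃ u : V →ₗ[F] V, (∀ v w, B (u v) (u w) = B v w) ∧
      (∀ v, B (y - x) v = 0 → u v = v) ∧ u x = y := by
  refine ⟨LinearMap.id - (B (y - x)).smulRight ((2 / B (y - x) (y - x)) • (y - x)), ?_, ?_, ?_⟩
  · intro v w
    generalize y - x = z at hz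
    simp only [LinearMap.sub_apply, LinearMap.id_apply, LinearMap.smulRight_apply, map_sub,
      map_smul, LinearMap.smul_apply, smul_eq_mul, hB v z]
    field_simp
    ring
  · intro v hv
    simp [-map_sub, hv]
  · have h : 2 * B (y - x) x = - B (y - x) (y - x) := by
      simp only [map_sub, LinearMap.sub_apply, hB x y]
      linear_combination -hxy
    have h' : B (y - x) x * (2 / B (y - x) (y - x)) = -1 := by
      field_simp
      linear_combination h
    rw [LinearMap.sub_apply, LinearMap.smulRight_apply, smul_smul, h']
    simp

/-- The Siegel transformation of an isotropic vector `z` and a vector `w` orthogonal to it. -/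
theorem exists_isometry_siegel (hchar : (2 : F) ≠ 0) (B : LinearMap.BilinForm F V)
    (hB : ∀ u v, B u v = B v u) {z w : V} (hz : B z z = 0) (hw : B w z = 0) :
    ∃ u : V →ₗ[F] V, (∀ v w, B (u v) (u w) = B v w) ∧
      ∀ v, B z v = 0 → u v = v + B w v • z := by
  refine ⟨LinearMap.id + (B w).smulRight z - (B z).smulRight w -
    (B z).smulRight ((B w w / 2) • z), ?_, ?_⟩
  · intro a b
    simp only [LinearMap.sub_apply, LinearMap.add_apply, LinearMap.id_apply,
      LinearMap.smulRight_apply, map_sub, map_add, map_smul, LinearMap.smul_apply, smul_eq_mul,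
      hB a z, hB a w, hB z w, hz, hw]
    field_simp
    ring
  · intro v hv
    simp [hv]

/-- The isometry scaling the two vectors of a hyperbolic pair by `c` and `c⁻¹`. -/
theorem exists_isometry_hyperbolic (B : LinearMap.BilinForm F V)
    (hB : ∀ u v, B u v = B v u) {z w : V} (hz : B z z = 0) (hw : B w w = 0) (hwz : B w z = 1)
    {c : F} (hc : c ≠ 0) :
    ∃ u : V →ₗ[F] V, (∀ v w, B (u v) (u w) = B v w) ∧
      (∀ v, B z v = 0 → u v = v + ((c - 1) * B w v) • z) := by
  refine ⟨LinearMap.id + (B w).smulRight ((c - 1) • z) + (B z).smulRight ((c⁻¹ - 1) • w), ?_, ?_⟩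
  · intro a b
    simp only [LinearMap.add_apply, LinearMap.id_apply,
      LinearMap.smulRight_apply, map_add, map_smul, LinearMap.smul_apply, smul_eq_mul,
      hB a z, hB a w, hB z w, hz, hw, hwz]
    field_simp
    ring
  · intro v hv
    simp [hv, smul_smul, mul_comm]

theorem injective_of_preserves_nondegenerate {B : LinearMap.BilinForm F V}
    (hnd : B.Nondegenerate) {u : V →ₗ[F] V} (hu : ∀ v w, B (u v) (u w) = B v w) :
    Function.Injective u := by
  refine (injective_iff_map_eq_zero u).2 fun v hv ↦ hnd.1 v fun w ↦ ?_
  rw [← hu, hv, map_zero, LinearMap.zero_apply]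

theorem map_orthogonal_eq {B : LinearMap.BilinForm F V} {B' : LinearMap.BilinForm F V'}
    {G : V ≃ₗ[F] V'} (hG : IsIsometry B B' G) (N : Submodule F V) :
    (B.orthogonal N).map G.toLinearMap = B'.orthogonal (N.map G.toLinearMap) := by
  ext v
  obtain ⟨v, rfl⟩ := G.surjective v
  refine G.injective.mem_set_image.trans ?_
  simp only [SetLike.mem_coe, LinearMap.BilinForm.mem_orthogonal_iff, Submodule.mem_map,
    forall_exists_index, and_imp, forall_apply_eq_imp_iff₂, LinearEquiv.coe_coe, hG _ _]

variable [FiniteDimensional F V]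

theorem exists_dual_vector_of_notMem {B : LinearMap.BilinForm F V} (hnd : B.Nondegenerate)
    {H : Submodule F V} {x : V} (hx : x ∉ H) : ∃ w, (∀ h ∈ H, B w h = 0) ∧ B w x = 1 := by
  obtain ⟨f, hf, hfx⟩ := LinearMap.exists_extend_of_notMem (0 : H →ₗ[F] F) hx 1
  have hw (v) : B ((B.toDual hnd).symm f) v = f v := by
    rw [← LinearMap.BilinForm.toDual_def hnd, LinearEquiv.apply_symm_apply]
  exact ⟨(B.toDual hnd).symm f, fun h hh ↦ (hw h).trans (LinearMap.congr_fun hf ⟨h, hh⟩),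
    (hw x).trans hfx⟩

/-- One-vector step of Witt's theorem: the pointwise stabilizer of `H` is transitive on vectors
outside `H` with prescribed length and prescribed products with `H`. -/
theorem exists_isometry_fixing (hchar : (2 : F) ≠ 0) {B : LinearMap.BilinForm F V}
    (hB : ∀ u v, B u v = B v u) (hnd : B.Nondegenerate) {H : Submodule F V} {x y : V}
    (hx : x ∉ H) (hy : y ∉ H) (hxy : B x x = B y y) (hH : ∀ h ∈ H, B x h = B y h) :
    ∃ u : V →ₗ[F] V, (∀ v w, B (u v) (u w) = B v w) ∧ (∀ h ∈ H, u h = h) ∧ u x = y := by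
  have hzH (h) (hh : h ∈ H) : B (y - x) h = 0 := by simp [hH h hh]
  by_cases hz : B (y - x) (y - x) = 0
  swap
  · obtain ⟨u, hu, hfix, hux⟩ := exists_isometry_of_anisotropic_sub B hB hxy hz
    exact ⟨u, hu, fun h hh ↦ hfix h (hzH h hh), hux⟩
  obtain ⟨z, rfl⟩ : ∃ z, y = x + z := ⟨y - x, by simp⟩
  rw [add_sub_cancel_left] at hz hzH
  have hzx : B z x = 0 := by
    refine (mul_eq_zero.1 (?_ : 2 * B z x = 0)).resolve_left hchar
    simp only [map_add, LinearMap.add_apply, hB x z] at hxy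
    linear_combination -hxy - hz
  by_cases hxz : x ∈ H ⊔ F ∙ z
  · obtain ⟨h, hh, _, hc, rfl⟩ := Submodule.mem_sup.1 hxz
    obtain ⟨c, rfl⟩ := Submodule.mem_span_singleton.1 hc
    have hc0 : c ≠ 0 := by
      rintro rfl
      exact hx (by simpa using hh)
    have hc1 : c + 1 ≠ 0 := by
      intro hc1
      refine hy ?_
      have hsum : c • z + z = (c + 1) • z := by rw [add_smul, one_smul]
      rwa [add_assoc, hsum, hc1, zero_smul, add_zero]
    have hzH' : z ∉ H := fun h' ↦ hx (H.add_mem hh (H.smul_mem c h'))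
    obtain ⟨w, hwH, hwz⟩ := exists_dual_vector_of_notMem hnd hzH'
    obtain ⟨u, hu, huz⟩ := exists_isometry_hyperbolic B hB (z := z) (w := w - (B w w / 2) • z)
      (c := (c + 1) / c) hz
      (by
        simp only [map_sub, map_smul, LinearMap.sub_apply, LinearMap.smul_apply, smul_eq_mul,
          hB z w, hz, hwz]
        field_simp
        ring)
      (by simp [hz, hwz]) (div_ne_zero hc1 hc0)
    refine ⟨u, hu, fun k hk ↦ ?_, ?_⟩
    · rw [huz k (hzH k hk)]
      simp [hwH k hk, hzH k hk]
    · have hsum : c • z + z = (c + 1) • z := by rw [add_smul, one_smul]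
      rw [huz _ hzx, add_assoc, add_assoc, ← add_smul, hsum]
      congr 2
      simp [hwH h hh, hzH h hh, hz, hwz]
      field_simp
      ring
  · obtain ⟨w, hw, hwx⟩ := exists_dual_vector_of_notMem hnd hxz
    obtain ⟨u, hu, huz⟩ := exists_isometry_siegel hchar B hB hz
      (hw z (Submodule.mem_sup_right (Submodule.mem_span_singleton_self z)))
    refine ⟨u, hu, fun h hh ↦ ?_, ?_⟩
    · rw [huz h (hzH h hh), hw h (Submodule.mem_sup_left hh), zero_smul, add_zero]
    · rw [huz x hzx, hwx, one_smul]

/-- Witt's extension theorem for a partial isometry of `V` into itself, given as the restriction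
to `E` of a linear map. -/
theorem exists_isometry_eqOn (hchar : (2 : F) ≠ 0) {B : LinearMap.BilinForm F V}
    (hB : ∀ u v, B u v = B v u) (hnd : B.Nondegenerate) (E : Submodule F V) (g : V →ₗ[F] V)
    (hg : ∀ u ∈ E, ∀ v ∈ E, B (g u) (g v) = B u v) (hinj : ∀ v ∈ E, g v = 0 → v = 0) :
    ∃ G : V →ₗ[F] V, (∀ v w, B (G v) (G w) = B v w) ∧ ∀ e ∈ E, G e = g e := by
  obtain ⟨s, rfl⟩ := IsNoetherian.noetherian E
  induction s using Finset.cons_induction with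
  | empty => exact ⟨LinearMap.id, by simp, by simp⟩
  | cons a s ha ih =>
  rw [Finset.coe_cons] at *
  have hle : Submodule.span F (s : Set V) ≤ Submodule.span F (insert a (s : Set V)) :=
    Submodule.span_mono (Set.subset_insert _ _)
  have haE : a ∈ Submodule.span F (insert a (s : Set V)) :=
    Submodule.subset_span (Set.mem_insert _ _)
  obtain ⟨G, hG, hGg⟩ := ih (fun u hu v hv ↦ hg u (hle hu) v (hle hv))
    fun v hv ↦ hinj v (hle hv)
  by_cases has : a ∈ Submodule.span F (s : Set V)
  · rw [Submodule.span_insert_eq_span has]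
    exact ⟨G, hG, hGg⟩
  have hGa : G a ∉ (Submodule.span F (s : Set V)).map G := by
    rintro ⟨b, hb, hba⟩
    exact has (injective_of_preserves_nondegenerate hnd hG hba ▸ hb)
  have hga : g a ∉ (Submodule.span F (s : Set V)).map G := by
    rintro ⟨b, hb, hba⟩
    rw [hGg b hb] at hba
    have : b - a = 0 := hinj _ (Submodule.sub_mem _ (hle hb) haE) (by simp [hba])
    exact has (sub_eq_zero.1 this ▸ hb)
  obtain ⟨u, hu, hfix, hua⟩ := exists_isometry_fixing hchar hB hnd hGa hga
    (by rw [hG, hg a haE a haE])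
    (by
      rintro _ ⟨b, hb, rfl⟩
      rw [hG, hGg b hb, hg a haE b (hle hb)])
  refine ⟨u ∘ₗ G, fun v w ↦ by simp [hu, hG], fun e he ↦ ?_⟩
  obtain ⟨c, b, hb, rfl⟩ := Submodule.mem_span_insert.1 he
  have hub := hfix _ (Submodule.mem_map_of_mem hb)
  rw [hGg b hb] at hub
  simp [hua, hGg b hb, hub]

/-- Witt's extension theorem between isometric nondegenerate spaces. -/
theorem exists_isometryEquiv_eqOn (hchar : (2 : F) ≠ 0) {B : LinearMap.BilinForm F V}
    {B' : LinearMap.BilinForm F V'} (hB : ∀ u v, B u v = B v u) (hnd : B.Nondegenerate)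
    (hVV' : AreIsometric B B') (E : Submodule F V) (g : V →ₗ[F] V')
    (hg : ∀ u ∈ E, ∀ v ∈ E, B' (g u) (g v) = B u v) (hinj : ∀ v ∈ E, g v = 0 → v = 0) :
    ∃ G : V ≃ₗ[F] V', IsIsometry B B' G ∧ ∀ e ∈ E, G e = g e := by
  obtain ⟨ψ, hψ⟩ := hVV'
  obtain ⟨G, hG, hGg⟩ := exists_isometry_eqOn hchar hB hnd E (ψ.symm.toLinearMap ∘ₗ g)
    (fun u hu v hv ↦ by simp [← hψ (ψ.symm _), hg u hu v hv])
    (fun v hv h ↦ hinj v hv (by simpa using h))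
  refine ⟨(LinearEquiv.ofInjectiveEndo G (injective_of_preserves_nondegenerate hnd hG)).trans ψ,
    fun u v ↦ ?_, fun e he ↦ ?_⟩
  · simp [hψ _ _, hG]
  · simp [hGg e he]

/-- The functionals on `E` given by pairing with the subspace `N` are determined by the
vectors of `E` orthogonal to `N`. -/
theorem range_pairing_eq {B : LinearMap.BilinForm F V} {B' : LinearMap.BilinForm F V'}
    {N : Submodule F V} {N' : Submodule F V'} {E : Submodule F V} (ι : E →ₗ[F] V')
    (h : ∀ e : E, (e : V) ∈ B.orthogonal N ↔ ι e ∈ B'.orthogonal N') :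
    (B.compl₁₂ N.subtype E.subtype).range = (B'.compl₁₂ N'.subtype ι).range := by
  have h' : (B.compl₁₂ N.subtype E.subtype).range.dualCoannihilator =
      (B'.compl₁₂ N'.subtype ι).range.dualCoannihilator := by
    ext e
    simp only [Submodule.mem_dualCoannihilator, LinearMap.mem_range, forall_exists_index,
      forall_apply_eq_imp_iff]
    simpa [LinearMap.BilinForm.mem_orthogonal_iff] using h e
  simpa only [Subspace.dualCoannihilator_dualAnnihilator_eq] using
    congrArg Submodule.dualAnnihilator h'

end Isometries

end Witt

open Module Witt

/-- Lemma 3.3 (the case `k = 3` of Theorem 3.2): for isometric self-dual flags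
`{0} ⊆ V₁ ⊆ V₂ ⊆ V` and `{0} ⊆ V₁' ⊆ V₂' ⊆ V'`, an isometry `φ : E → E'`
extends to an isometry `V → V'` sending `V₁` to `V₁'` and `V₂` to `V₂'` iff
`φ(E ∩ Vᵢ) = E' ∩ Vᵢ'` for `i = 1, 2`. -/
theorem witt_extension_selfdual_flag_k3 {F V V' : Type*} [Field F]
    [AddCommGroup V] [Module F V] [AddCommGroup V'] [Module F V']
    [FiniteDimensional F V] [FiniteDimensional F V']
    (hchar : (2 : F) ≠ 0)
    (B : LinearMap.BilinForm F V) (B' : LinearMap.BilinForm F V')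
    (hB : ∀ u v : V, B u v = B v u) (hB' : ∀ u v : V', B' u v = B' v u)
    (hnd : B.Nondegenerate) (hnd' : B'.Nondegenerate)
    (hVV' : AreIsometric B B')
    (V₁ V₂ : Submodule F V) (V₁' V₂' : Submodule F V')
    (h12 : V₁ ≤ V₂) (h12' : V₁' ≤ V₂')
    (hsd : B.orthogonal V₁ = V₂) (hsd' : B'.orthogonal V₁' = V₂')
    (hdim : finrank F ↥V₁ = finrank F ↥V₁')
    (E : Submodule F V) (E' : Submodule F V')
    (φ : E ≃ₗ[F] E') (hφ : IsIsometryOn B B' E E' φ) :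
    (∃ φV : V ≃ₗ[F] V', IsIsometry B B' φV ∧
        (∀ e : E, φV (e : V) = (φ e : V')) ∧
        V₁.map φV.toLinearMap = V₁' ∧ V₂.map φV.toLinearMap = V₂') ↔
      ((∀ e : E, (e : V) ∈ V₁ ↔ (φ e : V') ∈ V₁') ∧
       (∀ e : E, (e : V) ∈ V₂ ↔ (φ e : V') ∈ V₂')) := by
  constructor
  · rintro ⟨G, hG, hGφ, h₁, h₂⟩
    refine ⟨fun e ↦ ?_, fun e ↦ ?_⟩
    · rw [← hGφ, ← h₁]
      exact G.injective.mem_set_image.symm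
    · rw [← hGφ, ← h₂]
      exact G.injective.mem_set_image.symm
  rintro ⟨h₁, h₂⟩
  subst hsd hsd'
  let ι : E →ₗ[F] V' := E'.subtype ∘ₗ φ.toLinearMap
  have hισ : Function.Injective ι := E'.injective_subtype.comp φ.injective
  let α₀ : E.comap V₁.subtype →ₗ[F] E :=
    (V₁.subtype ∘ₗ (E.comap V₁.subtype).subtype).codRestrict E fun a ↦ a.2
  let α : E.comap V₁.subtype →ₗ[F] V₁' :=
    (ι ∘ₗ α₀).codRestrict V₁' fun a ↦ (h₁ (α₀ a)).1 a.1.2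
  obtain ⟨β, hβα, hβ, hβi⟩ := exists_injective_lift_extending
    (B.compl₁₂ V₁.subtype E.subtype) (B'.compl₁₂ V₁'.subtype ι) (range_pairing_eq ι h₂) hdim
    (E.comap V₁.subtype) α
    (fun a b hab ↦ by
      have hab' : α₀ a = α₀ b := hισ (congrArg (fun v : V₁' ↦ (v : V')) hab)
      exact Subtype.ext (Subtype.ext (congrArg (fun v : E ↦ (v : V)) hab')))
    (fun a ↦ LinearMap.ext fun e ↦ hφ (α₀ a) e)
  have hβB (v : V₁) (e : E) : B' (β v) (φ e) = B v e := LinearMap.congr_fun (hβ v) e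
  obtain ⟨g, hgE, hgV⟩ := exists_linearMap_eqOn_of_agree ι (V₁'.subtype ∘ₗ β) (by
    rintro e n h
    have hn : (n : V) ∈ E := h ▸ e.2
    have h' := congrArg Subtype.val (hβα ⟨n, hn⟩)
    obtain rfl : e = ⟨n, hn⟩ := Subtype.ext h
    exact h'.symm)
  have hgE' (e : E) : g e = φ e := hgE e
  have hgV' (v : V₁) : g v = β v := hgV v
  obtain ⟨G, hG, hGg⟩ := exists_isometryEquiv_eqOn hchar hB hnd hVV' (E ⊔ V₁) g
    (by
      intro u hu v hv
      obtain ⟨e, he, n, hn, rfl⟩ := Submodule.mem_sup.1 hu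
      obtain ⟨f, hf, m, hm, rfl⟩ := Submodule.mem_sup.1 hv
      lift e to E using he
      lift f to E using hf
      lift n to V₁ using hn
      lift m to V₁ using hm
      have hnm : B' (β n) (β m) = 0 := h12' (β m).2 _ (β n).2
      have hnm' : B n m = 0 := h12 m.2 _ n.2
      simp only [map_add, LinearMap.add_apply, hgE', hgV', hφ _ _, hβB, hB' (φ e) (β m), hnm,
        hnm', hB e m])
    (by
      intro v hv h0
      obtain ⟨e, he, n, hn, rfl⟩ := Submodule.mem_sup.1 hv
      lift e to E using he
      lift n to V₁ using hn
      have he : (e : V) ∈ V₁ := by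
        rw [h₁, ← hgE', eq_neg_of_add_eq_zero_left ((map_add g _ _).symm.trans h0), hgV']
        exact V₁'.neg_mem (β n).2
      have : g ((⟨e, he⟩ + n : V₁) : V) = 0 := h0
      rw [hgV'] at this
      exact congrArg Subtype.val (hβi ((Subtype.ext this).trans (map_zero β).symm)))
  have hGV : V₁.map G.toLinearMap = V₁' := by
    refine Submodule.eq_of_le_of_finrank_le ?_ ?_
    · rintro _ ⟨v, hv, rfl⟩
      have := hgV' ⟨v, hv⟩
      simp only at this
      rw [LinearEquiv.coe_coe, hGg v (Submodule.mem_sup_right hv), this]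
      exact (β _).2
    · rw [LinearEquiv.finrank_map_eq, hdim]
  refine ⟨G, hG, fun e ↦ ?_, hGV, ?_⟩
  · rw [hGg e (Submodule.mem_sup_left e.2), hgE']
  · rw [map_orthogonal_eq hG, hGV]
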